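/- arXiv:1512.02985 — 2 statements merged into one kernel-verified Lean document; each statement's English description precedes it below -/
import Mathlib

section
/- Let d ≥ 1, let X be a finite set of points in ℝ^d, let B be a closed Euclidean ball in ℝ^d with boundary sphere S, and let Z be a finite nonempty set of points in ℝ^d with the following property: every closed ball that contains a point of X and intersects S contains a point of Z. Then for every point p ∈ ℝ^d such that both X ∩ B and X \ B are nonempty, dist(p, Z) ≤ max( dist(p, X \ B), dist(p, X ∩ B) ), where the distance from a point to a finite set is the minimum of the distances to its points. -/
/-- Distance-bound half of Corollary 2: if a point set `Z` stabs every closed ball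
that contains a point of `X` and intersects the sphere `S` bounding the ball `B`,
then for every point `p`, `dist(p, Z) ≤ max(dist(p, X \ B), dist(p, X ∩ B))`. -/
theorem stmt_0 (d : ℕ) (hd : 1 ≤ d)
    (X Z : Finset (EuclideanSpace ℝ (Fin d)))
    (x : EuclideanSpace ℝ (Fin d)) (r : ℝ)
    (hZ : Z.Nonempty)
    (hstab : ∀ (y : EuclideanSpace ℝ (Fin d)) (s : ℝ),
      (∃ q ∈ X, q ∈ Metric.closedBall y s) →
      (Metric.closedBall y s ∩ Metric.sphere x r).Nonempty →
      ∃ z ∈ Z, z ∈ Metric.closedBall y s)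
    (p : EuclideanSpace ℝ (Fin d))
    (h1 : ((X : Set (EuclideanSpace ℝ (Fin d))) ∩ Metric.closedBall x r).Nonempty)
    (h2 : ((X : Set (EuclideanSpace ℝ (Fin d))) \ Metric.closedBall x r).Nonempty) :
    Metric.infDist p (Z : Set (EuclideanSpace ℝ (Fin d))) ≤
      max (Metric.infDist p ((X : Set (EuclideanSpace ℝ (Fin d))) \ Metric.closedBall x r))
          (Metric.infDist p ((X : Set (EuclideanSpace ℝ (Fin d))) ∩ Metric.closedBall x r)) := by
  obtain ⟨a, ha, hae⟩ := ((X.finite_toSet.inter_of_left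
    (Metric.closedBall x r)).isCompact).exists_infDist_eq_dist h1 p
  obtain ⟨b, hb, hbe⟩ := ((X.finite_toSet.subset
    (Set.diff_subset (t := Metric.closedBall x r))).isCompact).exists_infDist_eq_dist h2 p
  rw [hae, hbe]
  set M := max (dist p b) (dist p a) with hM
  have haM : a ∈ Metric.closedBall p M := by
    rw [Metric.mem_closedBall, dist_comm]; exact le_max_right _ _
  have hbM : b ∈ Metric.closedBall p M := by
    rw [Metric.mem_closedBall, dist_comm]; exact le_max_left _ _
  have har : dist a x ≤ r := ha.2
  have hbr : r ≤ dist b x := (not_le.mp hb.2).le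
  have hconn : IsPreconnected (Metric.closedBall p M) :=
    (convex_closedBall p M).isPreconnected
  obtain ⟨c, hc, hcr⟩ := hconn.intermediate_value haM hbM
    (f := fun y => dist y x) (by fun_prop) ⟨har, hbr⟩
  obtain ⟨z, hz, hzM⟩ := hstab p M ⟨a, ha.1, haM⟩ ⟨c, hc, hcr⟩
  refine (Metric.infDist_le_dist_of_mem (Finset.mem_coe.mpr hz)).trans ?_
  rw [dist_comm]; exact hzM
end

section
/- Let I ≥ 1, let Z_1, …, Z_I and T_1, …, T_{I−1} be finite sets of points of some type, and let B_1, …, B_I be sets, such that Z_1 = ∅ and Z_{i+1} = (Z_i \ B_i) ∪ T_i for all 1 ≤ i < I. Then Σ_{i=1}^{I} |Z_i ∩ B_i| ≤ Σ_{i=1}^{I−1} |T_i|. Consequently, Σ_{i=1}^{I} |T_i ∪ (Z_i ∩ B_i)| ≤ 2·Σ_{i=1}^{I} |T_i| (where T_I = ∅). -/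
/-- Observation 3, part 4 of the paper (combinatorial content): with `Z_1 = ∅` and
`Z_{i+1} = (Z_i \ B_i) ∪ T_i`, one has `Σ_{i=1}^{I} |Z_i ∩ B_i| ≤ Σ_{i=1}^{I−1} |T_i|`,
hence `Σ_{i=1}^{I} |T_i ∪ (Z_i ∩ B_i)| ≤ 2 Σ_{i=1}^{I} |T_i|` (with `T_I = ∅`). -/
theorem stmt_6 {α : Type*} (I : ℕ) (hI : 1 ≤ I)
    (Z T : ℕ → Set α) (B : ℕ → Set α)
    (hZfin : ∀ i, 1 ≤ i → i ≤ I → (Z i).Finite)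
    (hTfin : ∀ i, 1 ≤ i → i ≤ I → (T i).Finite)
    (hZ1 : Z 1 = ∅)
    (hZrec : ∀ i, 1 ≤ i → i < I → Z (i + 1) = (Z i \ B i) ∪ T i)
    (hTI : T I = ∅) :
    (∑ i ∈ Finset.Icc 1 I, (Z i ∩ B i).ncard ≤ ∑ i ∈ Finset.Icc 1 (I - 1), (T i).ncard) ∧
    (∑ i ∈ Finset.Icc 1 I, (T i ∪ (Z i ∩ B i)).ncard ≤ 2 * ∑ i ∈ Finset.Icc 1 I, (T i).ncard) := by
  have key : ∀ n, n + 1 ≤ I → ∑ i ∈ Finset.Icc 1 n, (Z i ∩ B i).ncard + (Z (n + 1)).ncard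
      ≤ ∑ i ∈ Finset.Icc 1 n, (T i).ncard := by
    intro n
    induction n with
    | zero => intro _; simp [hZ1]
    | succ k ih =>
      intro hk
      have h1 := ih (by omega)
      have h2 := hZrec (k + 1) (by omega) (by omega)
      have h3 := Set.ncard_union_le (Z (k + 1) \ B (k + 1)) (T (k + 1))
      have h4 := Set.ncard_inter_add_ncard_diff_eq_ncard (Z (k + 1)) (B (k + 1))
        (hZfin (k + 1) (by omega) (by omega))
      rw [Finset.sum_Icc_succ_top (by omega), Finset.sum_Icc_succ_top (by omega), h2]
      omega
  obtain ⟨n, rfl⟩ : ∃ n, I = n + 1 := ⟨I - 1, by omega⟩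
  have first : ∑ i ∈ Finset.Icc 1 (n + 1), (Z i ∩ B i).ncard
      ≤ ∑ i ∈ Finset.Icc 1 n, (T i).ncard := by
    have h1 := key n le_rfl
    have h2 := Set.ncard_le_ncard (Set.inter_subset_left (s := Z (n + 1)) (t := B (n + 1)))
      (hZfin (n + 1) (by omega) le_rfl)
    rw [Finset.sum_Icc_succ_top (by omega)]
    omega
  refine ⟨by simpa using first, ?_⟩
  have h5 : ∑ i ∈ Finset.Icc 1 (n + 1), (T i ∪ (Z i ∩ B i)).ncard
      ≤ ∑ i ∈ Finset.Icc 1 (n + 1), ((T i).ncard + (Z i ∩ B i).ncard) :=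
    Finset.sum_le_sum fun i _ => Set.ncard_union_le _ _
  rw [Finset.sum_add_distrib] at h5
  have h6 : ∑ i ∈ Finset.Icc 1 (n + 1), (T i).ncard
      = ∑ i ∈ Finset.Icc 1 n, (T i).ncard + (T (n + 1)).ncard :=
    Finset.sum_Icc_succ_top (by omega) _
  omega
end
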